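/- For every m ≥ 2 and n = 2m + 2 there exist real coefficients A_{i₁…i_{2m}} whose symbol Q satisfies Q(ξ) ≥ λ|ξ|^{2m} for some λ > 0, such that every function K : ℝⁿ → ℝ which is locally integrable, continuous on ℝⁿ\{0}, homogeneous of degree −2 = 2m−n, and a fundamental solution of the associated operator L attains both signs: there exist y, z ∈ ℝⁿ\{0} with K(y) > 0 and K(z) < 0 (so by homogeneity K changes sign in every punctured neighbourhood of 0). -/

import Mathlib

open MeasureTheory RealInnerProductSpace

noncomputable section

/-- ℝⁿ as a Euclidean space. -/
abbrev En (n : ℕ) : Type := EuclideanSpace ℝ (Fin n)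

/-- The `i`-th standard basis vector of ℝⁿ. -/
def stdB (n : ℕ) (i : Fin n) : En n := EuclideanSpace.single i 1

/-- The symbol Q(ξ) = Σ_{i₁,…,i_{2m}} A_{i₁…i_{2m}} ξ_{i₁}⋯ξ_{i_{2m}}. -/
def symbolQ (n m : ℕ) (A : (Fin (2*m) → Fin n) → ℝ) (ξ : En n) : ℝ :=
  ∑ i : Fin (2*m) → Fin n, A i * ∏ j, ξ (i j)

/-- The constant-coefficient operator
(Lψ)(x) = (−1)^m Σ A_{i₁…i_{2m}} ∂_{i₁}⋯∂_{i_{2m}} ψ(x). -/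
def opL (n m : ℕ) (A : (Fin (2*m) → Fin n) → ℝ) (ψ : En n → ℝ) (x : En n) : ℝ :=
  (-1 : ℝ)^m * ∑ i : Fin (2*m) → Fin n,
    A i * iteratedFDeriv ℝ (2*m) ψ x (fun j => stdB n (i j))

/-- K is a fundamental solution of L: ∫ K(y) (Lψ)(y) dy = ψ(0) for all ψ ∈ C_c^∞. -/
def IsFundamentalSolution (n m : ℕ) (A : (Fin (2*m) → Fin n) → ℝ) (K : En n → ℝ) : Prop :=
  ∀ ψ : En n → ℝ, ContDiff ℝ (⊤ : ℕ∞) ψ → HasCompactSupport ψ →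
    ∫ y, K y * opL n m A ψ y = ψ 0

/-- K is homogeneous of degree a: K(σx) = |σ|^a K(x) for σ ≠ 0, x ≠ 0. -/
def HomogeneousDeg (n : ℕ) (a : ℝ) (K : En n → ℝ) : Prop :=
  ∀ σ : ℝ, σ ≠ 0 → ∀ x : En n, x ≠ 0 → K (σ • x) = |σ| ^ a * K x

/-- The Euclidean Laplacian Δf(x) = Σ_i ∂²f/∂x_i²(x). -/
def lap (n : ℕ) (f : En n → ℝ) (x : En n) : ℝ :=
  ∑ i : Fin n, iteratedFDeriv ℝ 2 f x (fun _ => stdB n i)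

/-- The point (x′, t) ∈ ℝ^{d} × ℝ = ℝ^{d+1}. -/
def snocVec (d : ℕ) (x' : En d) (t : ℝ) : En (d+1) :=
  (EuclideanSpace.equiv (Fin (d+1)) ℝ).symm (Fin.snoc (fun i => x' i) t)

section Helpers
open SchwartzMap FourierTransform LineDeriv Filter Topology
open scoped ContDiff

theorem nat_le_infty (n : ℕ) : ((n : ℕ) : WithTop ℕ∞) ≤ ∞ := by exact_mod_cast (le_top : (n : ℕ∞) ≤ ⊤)

theorem norm_stdB (n : ℕ) (i : Fin n) : ‖stdB n i‖ = 1 := by simp [stdB]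

theorem opL_bound (n m : ℕ) (A : (Fin (2*m) → Fin n) → ℝ) (ψ : En n → ℝ) (x : En n) :
    |opL n m A ψ x| ≤ (∑ i, |A i|) * ‖iteratedFDeriv ℝ (2*m) ψ x‖ := by
  unfold opL
  rw [abs_mul, abs_pow, abs_neg, abs_one, one_pow, one_mul, Finset.sum_mul]
  refine (Finset.abs_sum_le_sum_abs _ _).trans (Finset.sum_le_sum fun i _ => ?_)
  rw [abs_mul]
  gcongr
  refine ((iteratedFDeriv ℝ (2*m) ψ x).le_opNorm _).trans ?_
  simp [norm_stdB]

theorem schwartz_ext (n m N : ℕ) (A : (Fin (2*m) → Fin n) → ℝ) (K : En n → ℝ)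
    (hKi : Integrable (fun y => K y * ((1+‖y‖)^N)⁻¹))
    (hfund : IsFundamentalSolution n m A K) (ψ : 𝓢(En n, ℝ)) :
    ∫ y, K y * opL n m A ψ y = ψ 0 := by
  let χ : ContDiffBump (0 : En n) := ⟨1, 2, one_pos, one_lt_two⟩
  have hχs : ContDiff ℝ ∞ (χ : En n → ℝ) := χ.contDiff
  have hχc : HasCompactSupport (χ : En n → ℝ) := χ.hasCompactSupport
  let X : 𝓢(En n, ℝ) := hχc.toSchwartzMap hχs
  let a : ℕ → ℝ := fun k => 1 / ((k:ℝ) + 1)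
  have ha0 : ∀ k, 0 < a k := fun k => by positivity
  have ha1 : ∀ k, a k ≤ 1 := fun k => by
    simp only [a]; rw [div_le_one (by positivity)]; linarith [(Nat.cast_nonneg k : (0:ℝ) ≤ k)]
  let f : ℕ → En n → ℝ := fun k x => χ (a k • x) * ψ x
  have hsm : ∀ k, ContDiff ℝ ∞ (fun x : En n => χ (a k • x)) := fun k =>
    hχs.comp (contDiff_const_smul _)
  have hfs : ∀ k, ContDiff ℝ ∞ (f k) := fun k => (hsm k).mul (ψ.smooth ⊤)
  have hfc : ∀ k, HasCompactSupport (f k) := fun k => by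
    apply HasCompactSupport.mul_right
    exact hχc.comp_homeomorph (Homeomorph.smulOfNeZero (a k) (ha0 k).ne')
  have hval : ∀ k, ∫ y, K y * opL n m A (f k) y = ψ 0 := fun k => by
    rw [hfund (f k) (hfs k) (hfc k)]
    simp only [f, smul_zero]
    rw [χ.one_of_mem_closedBall (by simp [χ])]
    simp
  -- bounds
  have hψb : ∀ j : ℕ, ∃ C, 0 ≤ C ∧ ∀ x, ‖iteratedFDeriv ℝ j ψ x‖ ≤ C * ((1+‖x‖)^N)⁻¹ := fun j => by
    refine ⟨2^N * ((Finset.Iic (N,j)).sup fun m => SchwartzMap.seminorm ℝ m.1 m.2) ψ,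
      by positivity, fun x => ?_⟩
    · have := one_add_le_sup_seminorm_apply (𝕜 := ℝ) (m := (N, j)) le_rfl le_rfl ψ x
      rw [← div_eq_mul_inv, le_div_iff₀ (by positivity), mul_comm]
      exact this
  have hXb : ∀ j : ℕ, ∃ C, 0 ≤ C ∧ ∀ x, ‖iteratedFDeriv ℝ j χ x‖ ≤ C := fun j => by
    obtain ⟨C, hC, h⟩ := X.decay 0 j
    refine ⟨C, hC.le, fun x => ?_⟩
    have := h x
    rw [pow_zero, one_mul] at this
    exact this
  choose C1 hC1 h1 using hψb
  choose C2 hC2 h2 using hXb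
  let C := ∑ i ∈ Finset.range (2*m+1), ((2*m).choose i : ℝ) * C2 i * C1 (2*m-i)
  have hbound : ∀ k x, ‖iteratedFDeriv ℝ (2*m) (f k) x‖ ≤ C * ((1+‖x‖)^N)⁻¹ := fun k x => by
    refine (norm_iteratedFDeriv_mul_le (N := ∞) (hsm k) (ψ.smooth ⊤) x (nat_le_infty _)).trans ?_
    rw [Finset.sum_mul]
    refine Finset.sum_le_sum fun i _ => ?_
    have : ‖iteratedFDeriv ℝ i (fun x : En n => χ (a k • x)) x‖ ≤ C2 i := by
      rw [iteratedFDeriv_comp_const_smul (a k) (hχs.of_le (mod_cast le_top))]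
      simp only [norm_smul, norm_pow, Real.norm_eq_abs, abs_of_pos (ha0 k)]
      calc _ ≤ 1 * C2 i := by
            gcongr
            · exact pow_le_one₀ (ha0 k).le (ha1 k)
            · exact h2 i _
        _ = _ := one_mul _
    calc _ ≤ ((2*m).choose i : ℝ) * C2 i * (C1 (2*m-i) * ((1+‖x‖)^N)⁻¹) := by
          gcongr
          · exact mul_nonneg (by positivity) (hC2 i)
          · exact h1 _ x
      _ = _ := by ring
  have hlim : Tendsto (fun k => ∫ y, K y * opL n m A (f k) y) atTop
      (𝓝 (∫ y, K y * opL n m A ψ y)) := by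
    have hKm : AEStronglyMeasurable K volume := by
      have h := hKi.aestronglyMeasurable.mul
        (show Continuous (fun y : En n => (1+‖y‖)^N) by fun_prop).aestronglyMeasurable
      refine h.congr (Eventually.of_forall fun y => ?_)
      have : ((1+‖y‖)^N) ≠ 0 := by positivity
      simp only [Pi.mul_apply]
      field_simp
    refine tendsto_integral_of_dominated_convergence
      (fun y => ((∑ i, |A i|) * C) * ‖K y * ((1+‖y‖)^N)⁻¹‖) (fun k => ?_) (hKi.norm.const_mul _)
      (fun k => Eventually.of_forall fun y => ?_) (Eventually.of_forall fun y => ?_)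
    · refine hKm.mul (Continuous.aestronglyMeasurable ?_)
      unfold opL
      have hc : Continuous (iteratedFDeriv ℝ (2*m) (f k)) :=
        (hfs k).continuous_iteratedFDeriv (nat_le_infty _)
      fun_prop
    · rw [norm_mul, norm_mul, Real.norm_eq_abs (opL _ _ _ _ _)]
      calc _ ≤ ‖K y‖ * ((∑ i, |A i|) * (C * ((1+‖y‖)^N)⁻¹)) := by
            gcongr
            refine (opL_bound _ _ _ _ _).trans ?_
            gcongr
            exact hbound k y
        _ = _ := by rw [Real.norm_of_nonneg (by positivity : 0 ≤ ((1+‖y‖)^N)⁻¹)]; ring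
    · refine tendsto_const_nhds.congr' ?_
      obtain ⟨k0, hk0⟩ := exists_nat_gt ‖y‖
      filter_upwards [eventually_ge_atTop k0] with k hk
      have hyk : ‖y‖ < k + 1 := by
        have : (k0:ℝ) ≤ k := by exact_mod_cast hk
        linarith
      have : (f k) =ᶠ[𝓝 y] ψ := by
        have : ∀ᶠ z in 𝓝 y, ‖z‖ < k + 1 := (continuous_norm.tendsto y).eventually_lt_const hyk
        filter_upwards [this] with z hz
        simp only [f]
        rw [χ.one_of_mem_closedBall, one_mul]
        simp only [χ, mem_closedBall_zero_iff, norm_smul, a, norm_div, norm_one]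
        rw [Real.norm_of_nonneg (by positivity), div_mul_eq_mul_div, one_mul,
          div_le_one (by positivity)]
        exact hz.le
      unfold opL
      rw [(this.iteratedFDeriv ℝ (2*m)).eq_of_nhds]
  simp only [hval] at hlim
  exact tendsto_nhds_unique hlim tendsto_const_nhds

/-- Homogeneous forms given by coefficient arrays. -/
def FormRep (n k : ℕ) (q : En n → ℝ) : Prop :=
  ∃ A : (Fin k → Fin n) → ℝ, ∀ ξ : En n, q ξ = ∑ i, A i * ∏ j, ξ (i j)

theorem FormRep.add {n k : ℕ} {p q : En n → ℝ} (hp : FormRep n k p) (hq : FormRep n k q) :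
    FormRep n k (fun ξ => p ξ + q ξ) := by
  obtain ⟨A, hA⟩ := hp
  obtain ⟨B, hB⟩ := hq
  refine ⟨fun i => A i + B i, fun ξ => ?_⟩
  simp only [hA, hB, add_mul, Finset.sum_add_distrib]

theorem FormRep.smul {n k : ℕ} {p : En n → ℝ} (c : ℝ) (hp : FormRep n k p) :
    FormRep n k (fun ξ => c * p ξ) := by
  obtain ⟨A, hA⟩ := hp
  refine ⟨fun i => c * A i, fun ξ => ?_⟩
  simp only [hA, Finset.mul_sum, mul_assoc]

theorem FormRep.mul {n k l : ℕ} {p q : En n → ℝ} (hp : FormRep n k p) (hq : FormRep n l q) :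
    FormRep n (k+l) (fun ξ => p ξ * q ξ) := by
  obtain ⟨A, hA⟩ := hp
  obtain ⟨B, hB⟩ := hq
  refine ⟨fun i => A (fun j => i (Fin.castAdd l j)) * B (fun j => i (Fin.natAdd k j)), fun ξ => ?_⟩
  beta_reduce
  rw [hA, hB, Finset.sum_mul_sum, ← Fintype.sum_prod_type', 
    ← (Fin.appendEquiv k l).sum_comp]
  refine Finset.sum_congr rfl fun x _ => ?_
  simp only [Fin.appendEquiv, Equiv.coe_fn_mk, Fin.append_left, Fin.append_right, Fin.prod_univ_add]
  ring

theorem FormRep.sum {n k : ℕ} {ι : Type*} (s : Finset ι) (p : ι → En n → ℝ) (hp : ∀ i, FormRep n k (p i)) :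
    FormRep n k (fun ξ => ∑ i ∈ s, p i ξ) := by
  choose A hA using hp
  refine ⟨fun i => ∑ j ∈ s, A j i, fun ξ => ?_⟩
  simp only [hA, Finset.sum_mul]
  exact Finset.sum_comm

theorem FormRep.coord {n : ℕ} (i : Fin n) : FormRep n 1 (fun ξ => ξ i) := by
  refine ⟨fun j => if j = (fun _ => i) then 1 else 0, fun ξ => ?_⟩
  simp

theorem FormRep.sq {n : ℕ} (i : Fin n) : FormRep n 2 (fun ξ => ξ i ^ 2) := by
  simp only [pow_two]
  exact (FormRep.coord i).mul (FormRep.coord i)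

theorem FormRep.normsq {n : ℕ} : FormRep n 2 (fun ξ => ‖ξ‖ ^ 2) := by
  simp only [EuclideanSpace.real_norm_sq_eq]
  exact FormRep.sum _ _ fun i => FormRep.sq i

theorem FormRep.one {n : ℕ} : FormRep n 0 (fun _ => 1) := ⟨fun _ => 1, by simp⟩

theorem FormRep.normpow {n : ℕ} (k : ℕ) : FormRep n (2*k) (fun ξ => ‖ξ‖ ^ (2*k)) := by
  induction k with
  | zero => simpa using FormRep.one
  | succ k ih =>
    have := ih.mul (FormRep.normsq (n := n))
    simp only [← pow_add] at this
    exact this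

/-- The symbol. -/
def Qs (n m : ℕ) (i : Fin n) (α ε : ℝ) (ξ : En n) : ℝ :=
  (ξ i ^ 2 - α * ‖ξ‖ ^ 2) ^ 2 * ‖ξ‖ ^ (2*(m-2)) + ε * ‖ξ‖ ^ (2*m)

theorem Qs_rep (n m : ℕ) (hm : 2 ≤ m) (i : Fin n) (α ε : ℝ) :
    ∃ A, ∀ ξ, symbolQ n m A ξ = Qs n m i α ε ξ := by
  have h1 : FormRep n 2 (fun ξ => ξ i ^ 2 + (-α) * ‖ξ‖ ^ 2) := (FormRep.sq i).add (FormRep.normsq.smul _)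
  have h2 := ((h1.mul h1).mul (FormRep.normpow (m-2)))
  rw [show 2 + 2 + 2 * (m-2) = 2 * m by omega] at h2
  obtain ⟨A, hA⟩ := h2.add ((FormRep.normpow m).smul ε)
  refine ⟨A, fun ξ => ?_⟩
  unfold symbolQ Qs
  rw [← hA]
  ring

theorem Qs_lower (n m : ℕ) (i : Fin n) (α ε : ℝ) (ξ : En n) : ε * ‖ξ‖ ^ (2*m) ≤ Qs n m i α ε ξ := by
  unfold Qs
  have : 0 ≤ (ξ i ^ 2 - α * ‖ξ‖ ^ 2) ^ 2 * ‖ξ‖ ^ (2*(m-2)) := by positivity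
  linarith

theorem Qs_smul (n m : ℕ) (hm : 2 ≤ m) (i : Fin n) (α ε : ℝ) (ξ : En n) (r : ℝ) (hr : 0 < r) :
    Qs n m i α ε (r • ξ) = r ^ (2*m) * Qs n m i α ε ξ := by
  unfold Qs
  obtain ⟨k, rfl⟩ := Nat.exists_eq_add_of_le hm
  simp only [norm_smul, Real.norm_of_nonneg hr.le, PiLp.smul_apply, smul_eq_mul]
  rw [show 2 + k - 2 = k by omega, show 2 * (2 + k) = 2*k + 4 by ring]
  ring

/-- Decay for homogeneous continuous functions. -/
theorem K_bound (n : ℕ) (a : ℝ) (K : En n → ℝ) (ha : a = -2)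
    (hc : ContinuousOn K {(0 : En n)}ᶜ) (hh : HomogeneousDeg n a K) :
    ∃ C, 0 ≤ C ∧ ∀ x, x ≠ 0 → |K x| ≤ C * (‖x‖ ^ 2)⁻¹ := by
  have hK : IsCompact (Metric.sphere (0 : En n) 1) := isCompact_sphere _ _
  obtain ⟨C, hC⟩ := hK.exists_bound_of_continuousOn (f := K) (hc.mono (by
    intro x hx
    simp only [Set.mem_compl_iff, Set.mem_singleton_iff]
    rintro rfl
    simp at hx))
  refine ⟨max C 0, le_max_right _ _, fun x hx => ?_⟩
  have hx' : 0 < ‖x‖ := norm_pos_iff.2 hx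
  have h1 : x = ‖x‖ • (‖x‖⁻¹ • x) := by rw [smul_smul, mul_inv_cancel₀ hx'.ne', one_smul]
  have h2 : ‖‖x‖⁻¹ • x‖ = 1 := by rw [norm_smul, norm_inv, norm_norm, inv_mul_cancel₀ hx'.ne']
  have h3 : ‖x‖⁻¹ • x ≠ 0 := by
    intro h; rw [h] at h2; simp at h2
  rw [h1, hh _ hx'.ne' _ h3, ← h1, abs_mul, ha, abs_norm, Real.rpow_neg hx'.le,
    mul_comm]
  rw [abs_of_pos (a := (_ : ℝ)⁻¹) (inv_pos.2 (Real.rpow_pos_of_pos hx' _))]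
  have h4 := (hC _ (by simpa using h2)).trans (le_max_left C 0)
  rw [Real.norm_eq_abs] at h4
  have h5 : ‖x‖ ^ (2:ℝ) = ‖x‖ ^ 2 := by norm_cast
  rw [h5]
  gcongr

theorem K_int (n : ℕ) (K : En n → ℝ) (C : ℝ) (hC0 : 0 ≤ C) (hC : ∀ x, x ≠ 0 → |K x| ≤ C * (‖x‖ ^ 2)⁻¹)
    (hK : LocallyIntegrable K volume) :
    Integrable (fun y => K y * ((1+‖y‖)^(n+1))⁻¹) := by
  have hd : Integrable (fun y : En n => ((1+‖y‖)^(n+1))⁻¹) := by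
    have := integrable_one_add_norm (E := En n) (μ := volume) (r := ((n+1 : ℕ) : ℝ)) (by simp)
    refine this.congr (Eventually.of_forall fun y => ?_)
    simp only
    rw [Real.rpow_neg (by positivity), Real.rpow_natCast]
  have hB : IntegrableOn K (Metric.closedBall 0 1) := hK.integrableOn_isCompact (isCompact_closedBall _ _)
  have hB2 := hB.integrable_indicator Metric.isClosed_closedBall.measurableSet
  refine (hB2.norm.add (hd.const_mul C)).mono' ?_ (Eventually.of_forall fun y => ?_)
  · exact hK.aestronglyMeasurable.mul hd.aestronglyMeasurable
  · rw [norm_mul, Real.norm_of_nonneg (show 0 ≤ ((1+‖y‖)^(n+1))⁻¹ by positivity)]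
    simp only [Pi.add_apply]
    by_cases hy : y ∈ Metric.closedBall (0 : En n) 1
    · rw [Set.indicator_of_mem hy]
      have : ((1+‖y‖)^(n+1))⁻¹ ≤ 1 := inv_le_one_of_one_le₀ (one_le_pow₀ (by simp))
      have h1 : ‖K y‖ * ((1+‖y‖)^(n+1))⁻¹ ≤ ‖K y‖ * 1 := by gcongr
      have h2 : 0 ≤ C * ((1+‖y‖)^(n+1))⁻¹ := by positivity
      linarith
    · rw [Set.indicator_of_notMem hy, norm_zero, zero_add]
      simp only [mem_closedBall_zero_iff, not_le] at hy
      have h0 : y ≠ 0 := by rintro rfl; simp at hy; linarith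
      gcongr
      rw [Real.norm_eq_abs]
      refine (hC y h0).trans (mul_le_of_le_one_right hC0 ?_)
      exact inv_le_one_of_one_le₀ (one_le_pow₀ hy.le)

theorem iter_fourierInv (n k : ℕ) (v : 𝓢(En n, ℂ)) (e : Fin k → En n) :
    ∃ u : 𝓢(En n, ℂ), (∀ ξ, u ξ = (2 * Real.pi * Complex.I)^k * ((∏ j, inner ℝ ξ (e j) : ℝ) : ℂ) * v ξ) ∧
      ∂^{e} (𝓕⁻ v) = 𝓕⁻ u := by
  induction k with
  | zero => exact ⟨v, by simp, by simp⟩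
  | succ k ih =>
    obtain ⟨u, hu, h⟩ := ih (Fin.tail e)
    refine ⟨(2 * Real.pi * Complex.I) • smulLeftCLM ℂ (inner ℝ · (e 0)) u, fun ξ => ?_, ?_⟩
    · rw [_root_.smul_apply, smulLeftCLM_apply_apply (by fun_prop), hu, Fin.prod_univ_succ, pow_succ]
      simp only [Fin.tail, smul_eq_mul, Complex.real_smul]
      push_cast
      ring
    · rw [iteratedLineDerivOp_succ_left, h, lineDerivOp_fourierInv_eq]

theorem opL_fourierInv (n m : ℕ) (A : (Fin (2*m) → Fin n) → ℝ) (v w : 𝓢(En n, ℂ))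
    (hw : ∀ ξ, w ξ = (((2 * Real.pi)^(2*m) * symbolQ n m A ξ : ℝ) : ℂ) * v ξ) (x : En n) :
    opL n m A (postcompCLM Complex.reCLM (𝓕⁻ v)) x = ((𝓕⁻ w) x).re := by
  choose u hu hd using fun i : Fin (2*m) → Fin n => iter_fourierInv n (2*m) v (fun j => stdB n (i j))
  have hw2 : w = ∑ i, ((-1 : ℝ)^m * A i) • u i := by
    ext ξ
    rw [hw, _root_.sum_apply]
    simp only [_root_.smul_apply, hu]
    unfold symbolQ
    rw [Finset.mul_sum]
    push_cast
    rw [Finset.sum_mul]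
    refine Finset.sum_congr rfl fun i _ => ?_
    have : ∀ j, inner ℝ ξ (stdB n j) = ξ j := fun j => by simp [stdB, EuclideanSpace.inner_single_right]
    simp only [this, Complex.real_smul]
    push_cast
    rw [mul_pow _ Complex.I, pow_mul Complex.I, Complex.I_sq]
    have h1 : ((-1:ℂ)^m)*(-1)^m = 1 := by rw [← mul_pow]; simp
    linear_combination (-(2 * Real.pi : ℂ)^(2*m) * (A i : ℂ) * (∏ j, (ξ (i j) : ℂ)) * v ξ) * h1
  have hfw : (𝓕⁻ w) x = ∑ i, ((-1 : ℝ)^m * A i) • (𝓕⁻ (u i)) x := by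
    have : 𝓕⁻ w = ∑ i, ((-1 : ℝ)^m * A i) • 𝓕⁻ (u i) := by
      rw [hw2]
      rw [FourierTransform.fourierInv_sum]
      simp only [FourierTransform.fourierInv_smul]
    rw [this, _root_.sum_apply]
    simp
  rw [hfw]
  unfold opL
  rw [Complex.re_sum, Finset.mul_sum]
  refine Finset.sum_congr rfl fun i _ => ?_
  rw [← hd, iteratedLineDerivOp_eq_iteratedFDeriv]
  have : (⇑(postcompCLM Complex.reCLM (𝓕⁻ v)) : En n → ℝ) = Complex.reCLM ∘ (⇑(𝓕⁻ v : 𝓢(En n, ℂ)) : En n → ℂ) := by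
    ext; rfl
  rw [this, ContinuousLinearMap.iteratedFDeriv_comp_left (n := ∞) _ ((𝓕⁻ v).smooth ⊤).contDiffAt (nat_le_infty _)]
  rw [Complex.smul_re, smul_eq_mul, mul_assoc]
  rfl

theorem inv_temperate {E : Type*} [NormedAddCommGroup E] [NormedSpace ℝ E] (a : E → ℝ)
    (ha : a.HasTemperateGrowth) (c : ℝ) (hc : 0 < c) (h : ∀ x, c ≤ a x) :
    (fun x => (a x)⁻¹).HasTemperateGrowth := by
  have ht' : IsOpen {y : ℝ | c / 2 < y} := isOpen_lt' _
  have key := Function.HasTemperateGrowth.comp' (g := fun y : ℝ => y⁻¹) (f := a) (t := {y : ℝ | c / 2 < y})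
    (by rintro _ ⟨x, rfl⟩; have := h x; simp only [Set.mem_setOf_eq]; linarith) ht'.uniqueDiffOn
    (fun y hy => (contDiffAt_inv ℝ (by
      simp only [Set.mem_setOf_eq] at hy
      have : 0 < y := by linarith
      exact this.ne')).contDiffWithinAt) ?_ ha
  · exact key
  · intro N
    refine ⟨0, (N.factorial : ℝ) * (1 + 2/c)^(N+1), by positivity, fun k hk y hy => ?_⟩
    rw [iteratedFDerivWithin_of_isOpen k ht' hy, norm_iteratedFDeriv_eq_norm_iteratedDeriv,
      iteratedDeriv_eq_iterate]
    change ‖deriv^[k] Inv.inv y‖ ≤ _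
    rw [iter_deriv_inv]
    simp only [Set.mem_setOf_eq] at hy
    have hy0 : 0 < y := by linarith
    rw [norm_mul, norm_mul, norm_pow, norm_neg, norm_one, one_pow, one_mul, pow_zero, mul_one,
      show (-1 - k : ℤ) = -((k+1 : ℕ) : ℤ) by push_cast; ring, zpow_neg, zpow_natCast, norm_inv,
      norm_pow, Real.norm_of_nonneg hy0.le, ← inv_pow, Real.norm_natCast]
    have h1 : y⁻¹ ≤ 1 + 2 / c := by
      have : y⁻¹ ≤ (c/2)⁻¹ := inv_anti₀ (by positivity) hy.le
      rw [inv_div] at this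
      linarith
    have h2 : (1:ℝ) ≤ 1 + 2/c := by
      have : 0 ≤ 2/c := by positivity
      linarith
    gcongr ?_ * ?_
    · exact_mod_cast Nat.factorial_le hk
    · calc y⁻¹^(k+1) ≤ (1+2/c)^(k+1) := by gcongr
        _ ≤ _ := pow_le_pow_right₀ h2 (by omega)

theorem Qs_temperate (n m : ℕ) (i : Fin n) (α ε : ℝ) : (Qs n m i α ε).HasTemperateGrowth := by
  have h1 : (fun ξ : En n => ξ i).HasTemperateGrowth := by
    have : (fun ξ : En n => inner ℝ ξ (stdB n i)).HasTemperateGrowth := by fun_prop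
    convert this using 2 with ξ
    simp [stdB, EuclideanSpace.inner_single_right]
  have h2 : (fun ξ : En n => ‖ξ‖ ^ 2).HasTemperateGrowth := by fun_prop
  have : Qs n m i α ε = fun ξ => (ξ i ^ 2 - α * ‖ξ‖ ^ 2) ^ 2 * (‖ξ‖ ^ 2)^(m-2) + ε * (‖ξ‖ ^ 2)^m := by
    ext ξ; simp only [Qs, pow_mul]
  rw [this]
  fun_prop

/-- A fixed cutoff. -/
def bmp (n : ℕ) : ContDiffBump (0 : En n) := ⟨1, 2, one_pos, one_lt_two⟩

theorem bmp_one (n : ℕ) (x : En n) (hx : ‖x‖ ≤ 1) : bmp n x = 1 :=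
  (bmp n).one_of_mem_closedBall (by simpa [bmp] using hx)

theorem bmp_zero (n : ℕ) (x : En n) (hx : 2 ≤ ‖x‖) : bmp n x = 0 :=
  (bmp n).zero_of_le_dist (by simpa [bmp] using hx)

theorem bmp_temp (n : ℕ) (s : ℝ) (hs : 0 < s) : (fun x : En n => bmp n (s • x)).HasTemperateGrowth := by
  apply HasCompactSupport.hasTemperateGrowth
  · exact (bmp n).hasCompactSupport.comp_homeomorph (Homeomorph.smulOfNeZero s hs.ne')
  · exact (bmp n).contDiff.comp (contDiff_const_smul _)

theorem exists_quot (n m : ℕ) (q : En n → ℝ) (hq : q.HasTemperateGrowth) (c : ℝ) (hc : 0 < c)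
    (hqc : ∀ ξ, c * ‖ξ‖ ^ (2*m) ≤ q ξ) (F : 𝓢(En n, ℂ)) (s : ℝ) (hs : 0 < s) :
    ∃ v : 𝓢(En n, ℂ), (∀ ξ, ((q ξ : ℝ) : ℂ) * v ξ = ((1 - bmp n (s • ξ) : ℝ) : ℂ) * F ξ) ∧ 
      ∀ ξ, v ξ = ((1 - bmp n (s • ξ) : ℝ) : ℂ) * F ξ / ((q ξ : ℝ) : ℂ) := by
  have hb := bmp_temp n s hs
  have hb2 := bmp_temp n (2*s) (by positivity)
  have hi := inv_temperate (fun ξ => q ξ + bmp n ((2*s) • ξ)) (hq.add hb2)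
    (min 1 (c * (1/(2*s))^(2*m))) (by positivity) (fun ξ => by
      rcases le_total ‖ξ‖ (1/(2*s)) with h | h
      · have : bmp n ((2*s) • ξ) = 1 := bmp_one n _ (by
          rw [norm_smul, Real.norm_of_nonneg (by positivity)]
          calc _ ≤ 2 * s * (1/(2*s)) := by gcongr
            _ = 1 := by field_simp)
        rw [this]
        have := hqc ξ
        have : 0 ≤ c * ‖ξ‖ ^ (2*m) := by positivity
        have := min_le_left 1 (c * (1/(2*s))^(2*m))
        linarith
      · have h1 : 0 ≤ bmp n ((2*s) • ξ) := (bmp n).nonneg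
        have h2 : c * (1/(2*s))^(2*m) ≤ c * ‖ξ‖ ^ (2*m) := by gcongr
        have := hqc ξ
        have := min_le_right 1 (c * (1/(2*s))^(2*m))
        linarith)
  have hg : (fun ξ => (1 - bmp n (s • ξ)) * (q ξ + bmp n ((2*s) • ξ))⁻¹).HasTemperateGrowth := by
    fun_prop
  have e2 : ∀ ξ, (1/s < ‖ξ‖) → 0 < q ξ := fun ξ h => by
    have : 0 < ‖ξ‖ := lt_trans (by positivity) h
    exact lt_of_lt_of_le (by positivity) (hqc ξ)
  have e1 : ∀ ξ, (smulLeftCLM ℂ (fun ξ => (1 - bmp n (s • ξ)) * (q ξ + bmp n ((2*s) • ξ))⁻¹) F) ξ =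
      ((1 - bmp n (s • ξ) : ℝ) : ℂ) * F ξ / ((q ξ : ℝ) : ℂ) := fun ξ => by
    rw [smulLeftCLM_apply_apply hg]
    rcases le_or_gt ‖ξ‖ (1/s) with h | h
    · have : bmp n (s • ξ) = 1 := bmp_one n _ (by
          rw [norm_smul, Real.norm_of_nonneg (by positivity)]
          calc _ ≤ s * (1/(s)) := by gcongr
            _ = 1 := by field_simp)
      simp [this]
    · have : bmp n ((2*s) • ξ) = 0 := bmp_zero n _ (by
          rw [norm_smul, Real.norm_of_nonneg (by positivity)]
          calc _ = 2 * s * (1/(s)) := by field_simp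
            _ ≤ _ := by gcongr)
      rw [this, add_zero, Complex.real_smul]
      push_cast
      ring
  refine ⟨smulLeftCLM ℂ (fun ξ => (1 - bmp n (s • ξ)) * (q ξ + bmp n ((2*s) • ξ))⁻¹) F, fun ξ => ?_, e1⟩
  rw [e1]
  rcases le_or_gt ‖ξ‖ (1/s) with h | h
  · have : bmp n (s • ξ) = 1 := bmp_one n _ (by
          rw [norm_smul, Real.norm_of_nonneg (by positivity)]
          calc _ ≤ s * (1/(s)) := by gcongr
            _ = 1 := by field_simp)
    simp [this]
  · have : ((q ξ : ℝ) : ℂ) ≠ 0 := by exact_mod_cast (e2 ξ h).ne'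
    field_simp

theorem conv_L1 (n : ℕ) (f g : En n → ℂ) (hf : Integrable f) (hg : Integrable g) :
    ∫ x, ‖convolution f g (ContinuousLinearMap.mul ℂ ℂ) volume x‖ ≤ (∫ x, ‖f x‖) * ∫ x, ‖g x‖ := by
  have h := integral_convolution (ContinuousLinearMap.mul ℝ ℝ) (μ := volume) (ν := volume) hf.norm hg.norm
  simp only [ContinuousLinearMap.mul_apply'] at h
  rw [← h]
  refine integral_mono (hf.integrable_convolution (ContinuousLinearMap.mul ℂ ℂ) hg).norm
    (hf.norm.integrable_convolution (ContinuousLinearMap.mul ℝ ℝ) hg.norm) fun x => ?_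
  simp only [convolution_def]
  refine (norm_integral_le_integral_norm _).trans (le_of_eq ?_)
  refine integral_congr_ae (Eventually.of_forall fun t => ?_)
  simp

/-- Cutoff as a Schwartz function. -/
def bmpS (n : ℕ) (s : ℝ) (hs : 0 < s) : 𝓢(En n, ℂ) :=
  HasCompactSupport.toSchwartzMap (f := fun x : En n => ((bmp n (s • x) : ℝ) : ℂ))
    (((bmp n).hasCompactSupport.comp_homeomorph (Homeomorph.smulOfNeZero s hs.ne')).comp_left
      (g := fun t : ℝ => (t : ℂ)) Complex.ofReal_zero)
    (Complex.ofRealCLM.contDiff.comp ((bmp n).contDiff.comp (contDiff_const_smul s)))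

theorem bmpS_apply (n : ℕ) (s : ℝ) (hs : 0 < s) (x : En n) : bmpS n s hs x = ((bmp n (s • x) : ℝ) : ℂ) := rfl

theorem bmpS_L1 (n : ℕ) (s : ℝ) (hs : 0 < s) :
    ∫ x, ‖(𝓕⁻ (bmpS n s hs) : 𝓢(En n, ℂ)) x‖ = ∫ x, ‖(𝓕⁻ (bmpS n 1 one_pos) : 𝓢(En n, ℂ)) x‖ := by
  have h1 : ∀ x : En n, (𝓕⁻ (bmpS n s hs) : 𝓢(En n, ℂ)) x =
      |(s ^ Module.finrank ℝ (En n))⁻¹| • (𝓕⁻ (bmpS n 1 one_pos) : 𝓢(En n, ℂ)) (s⁻¹ • x) := fun x => by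
    rw [fourierInv_coe, fourierInv_coe, Real.fourierInv_eq, Real.fourierInv_eq,
      ← Measure.integral_comp_smul]
    refine integral_congr_ae (Eventually.of_forall fun v => ?_)
    simp only [bmpS_apply, one_smul]
    rw [inner_smul_left, inner_smul_right]
    simp only [conj_trivial]
    rw [← mul_assoc, mul_inv_cancel₀ hs.ne', one_mul]
  simp only [h1, norm_smul]
  rw [integral_const_mul, Measure.integral_comp_smul (μ := volume)
    (fun x => ‖(𝓕⁻ (bmpS n 1 one_pos) : 𝓢(En n, ℂ)) x‖) s⁻¹]
  have hp : 0 < s ^ Module.finrank ℝ (En n) := by positivity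
  rw [smul_eq_mul, ← mul_assoc, inv_pow, inv_inv, Real.norm_eq_abs, abs_abs, abs_of_pos hp,
    abs_of_pos (inv_pos.2 hp), inv_mul_cancel₀ hp.ne', one_mul]

theorem E_L1 (n : ℕ) (F : 𝓢(En n, ℂ)) : ∃ M, 0 ≤ M ∧ ∀ (s : ℝ) (_ : 0 < s) (g : 𝓢(En n, ℂ)),
    (∀ ξ, g ξ = ((bmp n (s • ξ) : ℝ) : ℂ) * (𝓕 F : 𝓢(En n, ℂ)) ξ) → ∫ x, ‖(𝓕⁻ g : 𝓢(En n, ℂ)) x‖ ≤ M := by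
  refine ⟨(∫ x, ‖(𝓕⁻ (bmpS n 1 one_pos) : 𝓢(En n, ℂ)) x‖) * ∫ x, ‖F x‖, by positivity, fun s hs g hg => ?_⟩
  have h1 : 𝓕⁻ g = SchwartzMap.convolution (ContinuousLinearMap.mul ℂ ℂ) (𝓕⁻ (bmpS n s hs)) F := by
    have : g = 𝓕 (SchwartzMap.convolution (ContinuousLinearMap.mul ℂ ℂ) (𝓕⁻ (bmpS n s hs)) F) := by
      rw [SchwartzMap.fourier_convolution]
      ext ξ
      rw [hg]
      simp [bmpS_apply]
    rw [this]
    simp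
  rw [h1, ← bmpS_L1 n s hs]
  simp only [SchwartzMap.convolution_apply]
  exact conv_L1 n _ _ (SchwartzMap.integrable _) (SchwartzMap.integrable _)

theorem schwartz_bdd (n : ℕ) (h : 𝓢(En n, ℂ)) (N : ℕ) : ∃ C, 0 ≤ C ∧ ∀ x, ‖h x‖ ≤ C * ((1+‖x‖)^N)⁻¹ := by
  refine ⟨2^N * ((Finset.Iic (N,0)).sup fun m => SchwartzMap.seminorm ℝ m.1 m.2) h,
      by positivity, fun x => ?_⟩
  have := one_add_le_sup_seminorm_apply (𝕜 := ℝ) (m := (N, 0)) le_rfl le_rfl h x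
  rw [← div_eq_mul_inv, le_div_iff₀ (by positivity), mul_comm]
  simpa using this

theorem div_int (m : ℕ) (h : 𝓢(En (2*m+2), ℂ)) :
    Integrable (fun ξ : En (2*m+2) => (‖ξ‖^(2*m))⁻¹ * ‖h ξ‖) := by
  have hB : IntegrableOn (fun ξ : En (2*m+2) => (‖ξ‖^(2*m))⁻¹) (Metric.ball 0 1) := by
    rw [integrableOn_fun_norm_addHaar (f := fun r : ℝ => (r^(2*m))⁻¹) volume]
    have : IntegrableOn (fun y : ℝ => y) (Set.Ioo 0 1) :=
      (continuous_id.integrableOn_Icc (a := (0:ℝ)) (b := 1)).mono_set Set.Ioo_subset_Icc_self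
    refine this.congr_fun (fun y hy => ?_) measurableSet_Ioo
    have hy0 : y ≠ 0 := hy.1.ne'
    simp only [finrank_euclideanSpace, Fintype.card_fin, smul_eq_mul]
    rw [show 2 * m + 2 - 1 = 2*m + 1 by omega, pow_succ]
    field_simp
  have hB2 := hB.integrable_indicator measurableSet_ball
  obtain ⟨C, hC0, hC⟩ := schwartz_bdd _ h 0
  simp only [pow_zero, inv_one, mul_one] at hC
  refine ((hB2.const_mul C).add h.integrable.norm).mono' ?_ (Eventually.of_forall fun ξ => ?_)
  · refine AEStronglyMeasurable.mul ?_ h.continuous.norm.aestronglyMeasurable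
    exact (by fun_prop : Measurable fun ξ : En (2*m+2) => (‖ξ‖^(2*m))⁻¹).aestronglyMeasurable
  · rw [Real.norm_of_nonneg (by positivity)]
    simp only [Pi.add_apply]
    by_cases hx : ξ ∈ Metric.ball (0 : En (2*m+2)) 1
    · rw [Set.indicator_of_mem hx]
      have h1 : (‖ξ‖^(2*m))⁻¹ * ‖h ξ‖ ≤ (‖ξ‖^(2*m))⁻¹ * C := by gcongr; exact hC ξ
      have := norm_nonneg (h ξ)
      linarith
    · rw [Set.indicator_of_notMem hx, mul_zero, zero_add]
      simp only [mem_ball_zero_iff, not_lt] at hx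
      refine mul_le_of_le_one_left (norm_nonneg _) ?_
      exact inv_le_one_of_one_le₀ (one_le_pow₀ hx)

theorem K_mul_int (n : ℕ) (K : En n → ℝ) (N : ℕ)
    (hKi : Integrable (fun y => K y * ((1+‖y‖)^N)⁻¹)) (hKm : AEStronglyMeasurable K volume) (f : 𝓢(En n, ℂ)) :
    Integrable (fun y => K y * ‖f y‖) ∧ Integrable (fun y => K y * (f y).re) := by
  obtain ⟨C, hC0, hC⟩ := schwartz_bdd _ f N
  have h1 : Integrable (fun y => K y * ‖f y‖) := by
    refine (hKi.norm.const_mul C).mono' (hKm.mul f.continuous.norm.aestronglyMeasurable)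
      (Eventually.of_forall fun y => ?_)
    rw [norm_mul, norm_mul, norm_norm, Real.norm_of_nonneg (show 0 ≤ ((1+‖y‖)^N)⁻¹ by positivity)]
    calc _ ≤ ‖K y‖ * (C * ((1+‖y‖)^N)⁻¹) := by gcongr; exact hC y
      _ = _ := by ring
  refine ⟨h1, h1.mono (hKm.mul (Complex.continuous_re.comp f.continuous).aestronglyMeasurable) 
    (Eventually.of_forall fun y => ?_)⟩
  rw [norm_mul, norm_mul, norm_norm]
  gcongr
  exact Complex.abs_re_le_norm _

theorem B_small (n : ℕ) (K : En n → ℝ) (N : ℕ) (C : ℝ) (hC0 : 0 ≤ C)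
    (hC : ∀ x, x ≠ 0 → |K x| ≤ C * (‖x‖ ^ 2)⁻¹) (hK : LocallyIntegrable K volume)
    (hKi : Integrable (fun y => K y * ((1+‖y‖)^N)⁻¹)) (g : ℕ → 𝓢(En n, ℂ)) (δ : ℕ → ℝ)
    (hδ : Tendsto δ atTop (𝓝 0)) (hg : ∀ k x, ‖g k x‖ ≤ δ k) (M : ℝ) (hM : ∀ k, ∫ x, ‖g k x‖ ≤ M) :
    Tendsto (fun k => ∫ x, K x * (g k x).re) atTop (𝓝 0) := by
  have hδ0 : ∀ k, 0 ≤ δ k := fun k => (norm_nonneg _).trans (hg k 0)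
  have hM0 : 0 ≤ M := le_trans (by positivity) (hM 0)
  have key : ∀ R : ℝ, 0 < R → ∀ k, |∫ x, K x * (g k x).re| ≤
      δ k * (∫ x in Metric.closedBall 0 R, |K x|) + C * (R^2)⁻¹ * M := fun R hR k => by
    have hB : IntegrableOn K (Metric.closedBall 0 R) := hK.integrableOn_isCompact (isCompact_closedBall _ _)
    have hB1 : IntegrableOn (fun a => ‖K a‖) (Metric.closedBall 0 R) := Integrable.norm hB
    have hB2 := hB1.integrable_indicator Metric.isClosed_closedBall.measurableSet
    have hi := K_mul_int n K N hKi hK.aestronglyMeasurable (g k)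
    calc |∫ x, K x * (g k x).re| ≤ ∫ x, |K x * (g k x).re| := abs_integral_le_integral_abs
      _ ≤ ∫ x, (δ k * (Metric.closedBall 0 R).indicator (fun a => ‖K a‖) x + C * (R^2)⁻¹ * ‖g k x‖) := by
        refine integral_mono hi.2.norm ((hB2.const_mul _).add ((g k).integrable.norm.const_mul _)) fun x => ?_
        simp only [abs_mul]
        have h1 : |(g k x).re| ≤ ‖g k x‖ := Complex.abs_re_le_norm _
        by_cases hx : x ∈ Metric.closedBall (0 : En n) R
        · rw [Set.indicator_of_mem hx]
          have h2 : |K x| * |(g k x).re| ≤ |K x| * δ k := by gcongr; exact h1.trans (hg k x)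
          have h3 : 0 ≤ C * (R^2)⁻¹ * ‖g k x‖ := by positivity
          rw [Real.norm_eq_abs]
          linarith
        · rw [Set.indicator_of_notMem hx, mul_zero, zero_add]
          simp only [mem_closedBall_zero_iff, not_le] at hx
          have hx0 : x ≠ 0 := by rintro rfl; simp at hx; linarith
          refine mul_le_mul ((hC x hx0).trans ?_) h1 (abs_nonneg _) (by positivity)
          gcongr
      _ = δ k * (∫ x in Metric.closedBall 0 R, |K x|) + C * (R^2)⁻¹ * ∫ x, ‖g k x‖ := by
        rw [integral_add (hB2.const_mul _) ((g k).integrable.norm.const_mul _), integral_const_mul,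
          integral_const_mul, integral_indicator Metric.isClosed_closedBall.measurableSet]
        simp only [Real.norm_eq_abs]
      _ ≤ _ := by gcongr; exact hM k
  rw [Metric.tendsto_atTop]
  intro e he
  have h1 : Tendsto (fun R : ℝ => C * (R^2)⁻¹ * M) atTop (𝓝 0) := by
    have : Tendsto (fun R : ℝ => (R^2)⁻¹) atTop (𝓝 0) := tendsto_inv_atTop_zero.comp (tendsto_pow_atTop (by norm_num))
    simpa using (this.const_mul C).mul_const M
  obtain ⟨R, hR1, hR⟩ := ((h1.eventually_lt_const (half_pos he)).and (eventually_gt_atTop 0)).exists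
  have h2 : Tendsto (fun k => δ k * (∫ x in Metric.closedBall 0 R, |K x|)) atTop (𝓝 0) := by
    simpa using hδ.mul_const (∫ x in Metric.closedBall 0 R, |K x|)
  obtain ⟨k0, hk0⟩ := eventually_atTop.1 (h2.eventually_lt_const (half_pos he))
  refine ⟨k0, fun k hk => ?_⟩
  rw [Real.dist_eq, sub_zero]
  have := key R hR k
  have := hk0 k hk
  linarith

theorem main_ext (m : ℕ) (A : (Fin (2*m) → Fin (2*m+2)) → ℝ) (K : En (2*m+2) → ℝ) (q : En (2*m+2) → ℝ)
    (hAq : ∀ ξ, symbolQ (2*m+2) m A ξ = q ξ) (hq : q.HasTemperateGrowth) (c : ℝ) (hc : 0 < c)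
    (hqc : ∀ ξ, c * ‖ξ‖ ^ (2*m) ≤ q ξ) (C : ℝ) (hC0 : 0 ≤ C)
    (hC : ∀ x, x ≠ 0 → |K x| ≤ C * (‖x‖ ^ 2)⁻¹) (hK : LocallyIntegrable K volume)
    (hfund : IsFundamentalSolution (2*m+2) m A K) (F : 𝓢(En (2*m+2), ℂ)) :
    ∫ x, K x * (F x).re =
      (∫ ξ, (𝓕 F : 𝓢(En (2*m+2), ℂ)) ξ / (((2 * Real.pi)^(2*m) * q ξ : ℝ) : ℂ)).re := by
  have hKi := K_int _ K C hC0 hC hK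
  set p : En (2*m+2) → ℝ := fun ξ => (2 * Real.pi)^(2*m) * q ξ with hp
  have hpt : p.HasTemperateGrowth := by rw [hp]; fun_prop
  set c' := (2 * Real.pi)^(2*m) * c with hc'
  have hc'0 : 0 < c' := by positivity
  have hpc : ∀ ξ, c' * ‖ξ‖ ^ (2*m) ≤ p ξ := fun ξ => by
    rw [hc', hp, mul_assoc]
    beta_reduce
    gcongr
    exact hqc ξ
  set Fh : 𝓢(En (2*m+2), ℂ) := 𝓕 F with hFh
  have hs : ∀ k : ℕ, (0:ℝ) < k + 1 := fun k => by positivity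
  choose v hv1 hv2 using fun k : ℕ => exists_quot (2*m+2) m p hpt c' hc'0 hpc Fh (k+1) (hs k)
  let g : ℕ → 𝓢(En (2*m+2), ℂ) := fun k => smulLeftCLM ℂ (fun ξ : En (2*m+2) => bmp (2*m+2) (((k:ℝ)+1) • ξ)) Fh
  have hg : ∀ k ξ, g k ξ = ((bmp (2*m+2) (((k:ℝ)+1) • ξ) : ℝ) : ℂ) * Fh ξ := fun k ξ => by
    simp only [g]
    rw [smulLeftCLM_apply_apply (bmp_temp _ _ (hs k)), Complex.real_smul]
  obtain ⟨M, hM0, hM⟩ := E_L1 _ F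
  have hgb : ∀ k ξ, ‖g k ξ‖ ≤ ‖Fh ξ‖ := fun k ξ => by
    rw [hg, norm_mul, Complex.norm_real, Real.norm_of_nonneg (bmp _).nonneg]
    exact mul_le_of_le_one_left (norm_nonneg _) (bmp _).le_one
  have hae : ∀ᵐ ξ : En (2*m+2), ξ ≠ 0 := by
    have : volume ({0} : Set (En (2*m+2))) = 0 := measure_singleton _
    exact measure_eq_zero_iff_ae_notMem.1 this
  have hev : ∀ ξ : En (2*m+2), ξ ≠ 0 → ∀ᶠ k : ℕ in atTop, bmp (2*m+2) (((k:ℝ)+1) • ξ) = 0 := fun ξ hξ => by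
    have hξ' : 0 < ‖ξ‖ := norm_pos_iff.2 hξ
    obtain ⟨k0, hk0⟩ := exists_nat_gt (2 / ‖ξ‖)
    filter_upwards [eventually_ge_atTop k0] with k hk
    refine bmp_zero _ _ ?_
    rw [norm_smul, Real.norm_of_nonneg (hs k).le]
    have : (k0 : ℝ) ≤ k := by exact_mod_cast hk
    rw [div_lt_iff₀ hξ'] at hk0
    nlinarith
  have hδ : Tendsto (fun k => ∫ ξ, ‖g k ξ‖) atTop (𝓝 0) := by
    have : Tendsto (fun k => ∫ ξ, ‖g k ξ‖) atTop (𝓝 (∫ ξ : En (2*m+2), (0:ℝ))) := by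
      refine tendsto_integral_of_dominated_convergence (fun ξ => ‖Fh ξ‖)
        (fun k => (g k).continuous.norm.aestronglyMeasurable) Fh.integrable.norm
        (fun k => Eventually.of_forall fun ξ => by rw [norm_norm]; exact hgb k ξ) ?_
      filter_upwards [hae] with ξ hξ
      refine tendsto_const_nhds.congr' ?_
      filter_upwards [hev ξ hξ] with k hk
      rw [hg, hk]; simp
    simpa using this
  have hsup : ∀ k x, ‖(𝓕⁻ (g k) : 𝓢(En (2*m+2), ℂ)) x‖ ≤ ∫ ξ, ‖g k ξ‖ := fun k x => by
    rw [fourierInv_coe, Real.fourierInv_eq]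
    refine (norm_integral_le_integral_norm _).trans (le_of_eq ?_)
    simp
  have hlim1 := B_small _ K _ C hC0 hC hK hKi (fun k => 𝓕⁻ (g k)) _ hδ hsup M
    (fun k => hM _ (hs k) (g k) (hg k))
  have hid : ∀ k, (∫ x, K x * (F x).re) - ∫ x, K x * ((𝓕⁻ (g k) : 𝓢(En (2*m+2), ℂ)) x).re = (∫ ξ, v k ξ).re := fun k => by
    have h1 := schwartz_ext _ m _ A K hKi hfund (postcompCLM Complex.reCLM (𝓕⁻ (v k)))
    have h2 : (∫ ξ, v k ξ).re = (postcompCLM Complex.reCLM (𝓕⁻ (v k))) 0 := by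
      rw [postcompCLM_apply, fourierInv_coe, Real.fourierInv_eq]
      simp
    rw [h2, ← h1, ← integral_sub (K_mul_int _ K _ hKi hK.aestronglyMeasurable F).2
      (K_mul_int _ K _ hKi hK.aestronglyMeasurable (𝓕⁻ (g k))).2]
    refine integral_congr_ae (Eventually.of_forall fun x => ?_)
    beta_reduce
    rw [opL_fourierInv _ m A (v k) (Fh - g k) (fun ξ => ?_) x]
    · rw [sub_eq_add_neg Fh, FourierTransform.fourierInv_add, FourierTransform.fourierInv_neg, hFh]
      simp
      ring
    · rw [hAq]
      have := hv1 k ξ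
      simp only [hp] at this
      rw [this, _root_.sub_apply, hg]
      push_cast
      ring
  have hlim2 : Tendsto (fun k => ∫ ξ, v k ξ) atTop (𝓝 (∫ ξ, Fh ξ / ((p ξ : ℝ) : ℂ))) := by
    refine tendsto_integral_of_dominated_convergence (fun ξ => c'⁻¹ * ((‖ξ‖^(2*m))⁻¹ * ‖Fh ξ‖))
        (fun k => (v k).continuous.aestronglyMeasurable) ((div_int m Fh).const_mul _)
        (fun k => ?_) ?_
    · filter_upwards [hae] with ξ hξ
      have hξ' : 0 < ‖ξ‖ := norm_pos_iff.2 hξ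
      have h0 : 0 < c' * ‖ξ‖^(2*m) := by positivity
      have hp0 := h0.trans_le (hpc ξ)
      rw [hv2, norm_div, norm_mul, Complex.norm_real, Complex.norm_real, Real.norm_of_nonneg hp0.le,
        Real.norm_of_nonneg (sub_nonneg.2 (bmp _).le_one)]
      calc _ ≤ 1 * ‖Fh ξ‖ / (c' * ‖ξ‖^(2*m)) := by
            gcongr
            · have : 0 ≤ bmp (2*m+2) (((k:ℝ)+1) • ξ) := (bmp _).nonneg
              linarith
            · exact hpc ξ
        _ = _ := by field_simp
    · filter_upwards [hae] with ξ hξ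
      refine tendsto_const_nhds.congr' ?_
      filter_upwards [hev ξ hξ] with k hk
      rw [hv2, hk]; simp
  have hlim3 := (Complex.continuous_re.tendsto _).comp hlim2
  have hlim4 := (tendsto_const_nhds (x := ∫ x, K x * (F x).re)).sub hlim1
  rw [sub_zero] at hlim4
  exact tendsto_nhds_unique hlim4 (hlim3.congr fun k => (hid k).symm)

theorem pow_mul_gauss (N : ℕ) (t : ℝ) (ht : 0 ≤ t) :
    (1+t)^N * Real.exp (-Real.pi * t^2) ≤ N.factorial * Real.exp 2 := by
  have h1 : Real.exp (-Real.pi * t^2) ≤ Real.exp 2 * Real.exp (-(1+t)) := by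
    rw [← Real.exp_add]
    apply Real.exp_le_exp.2
    nlinarith [Real.pi_gt_three, sq_nonneg (t-1/2), sq_nonneg t]
  have h2 := Real.pow_div_factorial_le_exp (x := 1+t) (by positivity) N
  rw [div_le_iff₀ (by positivity)] at h2
  calc _ ≤ (Real.exp (1+t) * N.factorial) * (Real.exp 2 * Real.exp (-(1+t))) := by gcongr
    _ = (N.factorial * Real.exp 2) * (Real.exp (1+t) * Real.exp (-(1+t))) := by ring
    _ = _ := by rw [← Real.exp_add]; simp

/-- Gaussian as a real Schwartz function. -/
def gaussR (n : ℕ) : 𝓢(En n, ℝ) where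
  toFun := fun x => Real.exp (-Real.pi * ‖x‖^2)
  smooth' := by
    have : ContDiff ℝ ∞ (fun x : En n => ‖x‖^2) := contDiff_norm_sq ℝ
    fun_prop
  decay' := fun p j => by
    have hf : (fun x : En n => -Real.pi * ‖x‖^2).HasTemperateGrowth := by fun_prop
    obtain ⟨k, C, hC0, hC⟩ := hf.norm_iteratedFDeriv_le_uniform j
    refine ⟨j.factorial * (1+C)^j * ((p + k*j).factorial * Real.exp 2), fun x => ?_⟩
    have h1 : 1 ≤ (1+‖x‖)^k := one_le_pow₀ (by simp)
    have hb := norm_iteratedFDeriv_comp_le (𝕜 := ℝ) (g := Real.exp) (f := fun x : En n => -Real.pi * ‖x‖^2)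
      (n := j) (N := ∞) Real.contDiff_exp hf.1 (nat_le_infty _) x (C := Real.exp (-Real.pi * ‖x‖^2))
      (D := (1+C) * (1+‖x‖)^k) (fun i _ => by
        rw [norm_iteratedFDeriv_eq_norm_iteratedDeriv, iteratedDeriv_eq_iterate, Real.iter_deriv_exp,
          Real.norm_of_nonneg (Real.exp_pos _).le]) (fun i hi1 hi => by
        refine (hC i hi x).trans ?_
        have h2 : 1 ≤ (1+C) * (1+‖x‖)^k := by nlinarith
        calc _ ≤ (1+C) * (1+‖x‖)^k := by gcongr; linarith
          _ ≤ _ := le_self_pow₀ h2 (by omega))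
    change ‖x‖^p * ‖iteratedFDeriv ℝ j (Real.exp ∘ fun x : En n => -Real.pi * ‖x‖^2) x‖ ≤ _
    calc _ ≤ (1+‖x‖)^p * (j.factorial * Real.exp (-Real.pi * ‖x‖^2) * ((1+C) * (1+‖x‖)^k)^j) := by
          gcongr; linarith
      _ = j.factorial * (1+C)^j * ((1+‖x‖)^(p + k*j) * Real.exp (-Real.pi * ‖x‖^2)) := by
          rw [mul_pow, ← pow_mul, pow_add]; ring
      _ ≤ _ := mul_le_mul_of_nonneg_left (pow_mul_gauss _ _ (norm_nonneg x)) (by positivity)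

/-- Complex Gaussian. -/
def gaussC (n : ℕ) : 𝓢(En n, ℂ) := postcompCLM Complex.ofRealCLM (gaussR n)

theorem gaussC_apply (n : ℕ) (x : En n) : gaussC n x = ((Real.exp (-Real.pi * ‖x‖^2) : ℝ) : ℂ) := rfl

theorem gaussC_fourier (n : ℕ) : 𝓕 (gaussC n) = gaussC n := by
  ext w
  rw [fourier_coe]
  have : (gaussC n : En n → ℂ) = fun v => Complex.exp (-(Real.pi : ℂ) * ‖v‖^2) := by
    ext v; rw [gaussC_apply]; push_cast; rfl
  rw [this, fourier_gaussian_innerProductSpace (by simpa using Real.pi_pos)]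
  have hpi : (Real.pi : ℂ) ≠ 0 := by exact_mod_cast Real.pi_ne_zero
  rw [div_self hpi, Complex.one_cpow, one_mul]
  congr 1
  field_simp

/-- Gaussian multiplied by a coordinate. -/
def tG (n : ℕ) (e : En n) : 𝓢(En n, ℂ) := smulLeftCLM ℂ (inner ℝ · e) (gaussC n)

/-- Gaussian multiplied by a squared coordinate. -/
def ttG (n : ℕ) (e : En n) : 𝓢(En n, ℂ) := smulLeftCLM ℂ (inner ℝ · e) (tG n e)

theorem tG_apply (n : ℕ) (e x : En n) : tG n e x = ((inner ℝ x e * Real.exp (-Real.pi * ‖x‖^2) : ℝ) : ℂ) := by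
  unfold tG
  rw [smulLeftCLM_apply_apply (by fun_prop), gaussC_apply, Complex.real_smul]
  push_cast; rfl

theorem ttG_apply (n : ℕ) (e x : En n) : ttG n e x = ((inner ℝ x e ^ 2 * Real.exp (-Real.pi * ‖x‖^2) : ℝ) : ℂ) := by
  unfold ttG
  rw [smulLeftCLM_apply_apply (by fun_prop), tG_apply, Complex.real_smul]
  push_cast; ring

theorem hasFDeriv_gauss (n : ℕ) (x : En n) : HasFDerivAt (fun x : En n => Real.exp (-Real.pi * ‖x‖^2))
    (Real.exp (-Real.pi * ‖x‖^2) • ((-Real.pi) • (2 • innerSL ℝ x))) x := 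
  (((hasStrictFDerivAt_norm_sq x).hasFDerivAt).const_mul (-Real.pi)).exp

theorem deriv_gauss (n : ℕ) (e : En n) : ∂_{e} (gaussC n) = ((-(2 * Real.pi) : ℝ) : ℂ) • tG n e := by
  ext x
  rw [lineDerivOp_apply_eq_fderiv, _root_.smul_apply, tG_apply]
  have h := (Complex.ofRealCLM.hasFDerivAt.comp x (hasFDeriv_gauss n x)).fderiv
  have h2 : (⇑(gaussC n) : En n → ℂ) = Complex.ofRealCLM ∘ (fun x : En n => Real.exp (-Real.pi * ‖x‖^2)) := rfl
  rw [h2, h]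
  simp
  ring

theorem deriv_tG (n : ℕ) (e : En n) (he : ‖e‖ = 1) :
    ∂_{e} (tG n e) = gaussC n + ((-(2 * Real.pi) : ℝ) : ℂ) • ttG n e := by
  ext x
  rw [lineDerivOp_apply_eq_fderiv, _root_.add_apply, _root_.smul_apply, ttG_apply, gaussC_apply]
  have h1 : HasFDerivAt (fun x : En n => inner ℝ x e) ((innerSL ℝ).flip e) x :=
    ((innerSL ℝ).flip e).hasFDerivAt
  have h := (Complex.ofRealCLM.hasFDerivAt.comp x (h1.mul (hasFDeriv_gauss n x))).fderiv
  have h2 : (⇑(tG n e) : En n → ℂ) = Complex.ofRealCLM ∘ 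
      ((fun x : En n => inner ℝ x e) * (fun x : En n => Real.exp (-Real.pi * ‖x‖^2))) := by
    ext x; rw [tG_apply]; rfl
  rw [h2, h]
  have h3 : innerSL ℝ e e = 1 := by
    rw [innerSL_apply_apply, real_inner_self_eq_norm_sq, he, one_pow]
  simp [h3]
  ring

theorem fourier_ttG (n : ℕ) (e : En n) (he : ‖e‖ = 1) (ξ : En n) :
    (𝓕 (ttG n e) : 𝓢(En n, ℂ)) ξ =
      (((1 / (2 * Real.pi) - inner ℝ ξ e ^ 2) * Real.exp (-Real.pi * ‖ξ‖^2) : ℝ) : ℂ) := by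
  have hpi : (Real.pi : ℂ) ≠ 0 := by exact_mod_cast Real.pi_ne_zero
  have hI := Complex.I_ne_zero
  have h1 := lineDerivOp_fourier_eq (gaussC n) e
  rw [gaussC_fourier, deriv_gauss, FourierTransform.fourier_smul] at h1
  have h2 := lineDerivOp_fourier_eq (tG n e) e
  rw [FourierTransform.fourier_smul] at h2
  have h3 : 𝓕 (tG n e) = (-Complex.I) • tG n e := by
    ext x
    have := congrArg (fun f : 𝓢(En n, ℂ) => f x) h1
    simp only [_root_.smul_apply, smul_eq_mul] at this
    change _ = -(2 * Real.pi * Complex.I) * (𝓕 (tG n e) : 𝓢(En n, ℂ)) x at this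
    rw [_root_.smul_apply, smul_eq_mul]
    have h2pi : (-(2 * (Real.pi:ℂ) * Complex.I)) ≠ 0 := by simp [hpi]
    apply mul_left_cancel₀ h2pi
    rw [← this]
    push_cast
    linear_combination (-2 * (Real.pi : ℂ) * tG n e x) * Complex.I_sq
  rw [h3, LineDeriv.lineDerivOp_smul, deriv_tG n e he] at h2
  have := congrArg (fun f : 𝓢(En n, ℂ) => f ξ) h2
  simp only [_root_.smul_apply, _root_.add_apply, smul_eq_mul] at this
  change _ = -(2 * Real.pi * Complex.I) * (𝓕 (ttG n e) : 𝓢(En n, ℂ)) ξ at this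
  have h2pi : (-(2 * (Real.pi:ℂ) * Complex.I)) ≠ 0 := by simp [hpi]
  apply mul_left_cancel₀ h2pi
  rw [← this, gaussC_apply, ttG_apply]
  push_cast
  field_simp
  ring

theorem int_pos (n : ℕ) (f : En n → ℝ) (hf : Integrable f) (h0 : ∀ x, 0 ≤ f x) (V : Set (En n))
    (hV : IsOpen V) (hne : V.Nonempty) (hp : ∀ x ∈ V, 0 < f x) : 0 < ∫ x, f x := by
  rw [integral_pos_iff_support_of_nonneg h0 hf]
  refine lt_of_lt_of_le (hV.measure_pos volume hne) (measure_mono fun x hx => ?_)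
  exact (hp x hx).ne'

theorem pointwise_sum (N : ℕ) (hN : 0 < N) (S : ℝ) (h0 : 0 ≤ S) (h1 : S ≤ 1) :
    (if 0.7 < S ∧ S < 0.8 then 4.75 * (N:ℝ)^2 else 0) - 68 * (N:ℝ) ≤
      ∑ j ∈ Finset.range N, (S - 0.605) / ((S - (0.7 + (j:ℝ) * (0.1/(N:ℝ))))^2 + (0.1/(N:ℝ))^2) := by
  have hN' : (0:ℝ) < N := by exact_mod_cast hN
  have hδ : 0 < 0.1 / (N:ℝ) := by positivity
  split_ifs with h
  · obtain ⟨ha, hb⟩ := h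
    have hnn : ∀ j ∈ Finset.range N, 0 ≤ (S - 0.605) / ((S - (0.7 + j * (0.1/N)))^2 + (0.1/N)^2) := 
      fun j _ => div_nonneg (by linarith) (by positivity)
    set j := ⌊(S - 0.7) / (0.1/N)⌋₊ with hj
    have hx0 : 0 ≤ (S - 0.7) / (0.1/N) := div_nonneg (by linarith) hδ.le
    have hj1 : (j:ℝ) ≤ (S - 0.7) / (0.1/N) := Nat.floor_le hx0
    have hj2 : (S - 0.7) / (0.1/N) < j + 1 := Nat.lt_floor_add_one _
    rw [le_div_iff₀ hδ] at hj1
    rw [div_lt_iff₀ hδ] at hj2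
    have hjN : j < N := by
      have : (j:ℝ) * (0.1/N) < N * (0.1/N) := by
        have : N * (0.1/(N:ℝ)) = 0.1 := by field_simp
        linarith
      have := lt_of_mul_lt_mul_right this hδ.le
      exact_mod_cast this
    refine le_trans ?_ (Finset.single_le_sum hnn (Finset.mem_range.2 hjN))
    rw [le_div_iff₀ (by positivity)]
    have h2 : (S - (0.7 + j * (0.1/N)))^2 ≤ (0.1/(N:ℝ))^2 := by
      apply pow_le_pow_left₀ <;> linarith
    have h3 : (4.75 * (N:ℝ)^2 - 68 * N) * ((S - (0.7 + j * (0.1/N)))^2 + (0.1/N)^2) ≤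
       (4.75 * (N:ℝ)^2) * ((0.1/(N:ℝ))^2 + (0.1/N)^2) := by
      apply mul_le_mul
      · linarith
      · linarith
      · positivity
      · positivity
    have h4 : (4.75 * (N:ℝ)^2) * ((0.1/(N:ℝ))^2 + (0.1/N)^2) = 0.095 := by
      field_simp; norm_num
    linarith
  · have : ∀ j ∈ Finset.range N, (-68:ℝ) ≤ (S - 0.605) / ((S - (0.7 + j * (0.1/N)))^2 + (0.1/N)^2) := by
      intro j _
      rw [le_div_iff₀ (by positivity)]
      have hj0 : 0 ≤ (j:ℝ) * (0.1/N) := by positivity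
      have hd2 : 0 ≤ (0.1/(N:ℝ))^2 := by positivity
      rcases le_total 0.605 S with hS | hS
      · nlinarith [sq_nonneg (S - (0.7 + j * (0.1/N)))]
      · have : (0.095:ℝ)^2 ≤ (S - (0.7 + j * (0.1/N)))^2 := by
          rw [← neg_sq (S - _)]
          apply pow_le_pow_left₀ <;> linarith
        norm_num at this
        linarith
    have := Finset.card_nsmul_le_sum _ _ _ this
    simp only [Finset.card_range, nsmul_eq_mul] at this
    linarith

/-- Gaussian times norm squared. -/
def nG (n : ℕ) : 𝓢(En n, ℂ) := smulLeftCLM ℂ (fun x : En n => ‖x‖^2) (gaussC n)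

theorem nG_norm (n : ℕ) (x : En n) : ‖nG n x‖ = ‖x‖^2 * Real.exp (-Real.pi * ‖x‖^2) := by
  unfold nG
  rw [smulLeftCLM_apply_apply (by fun_prop), gaussC_apply, norm_smul, Complex.norm_real,
    Real.norm_of_nonneg (by positivity), Real.norm_of_nonneg (by positivity)]

theorem gaussC_norm (n : ℕ) (x : En n) : ‖gaussC n x‖ = Real.exp (-Real.pi * ‖x‖^2) := by
  rw [gaussC_apply, Complex.norm_real, Real.norm_of_nonneg (by positivity)]

theorem coord_sq_le (n : ℕ) (i : Fin n) (ξ : En n) : ξ i ^ 2 ≤ ‖ξ‖^2 := by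
  rw [EuclideanSpace.real_norm_sq_eq]
  exact Finset.single_le_sum (f := fun j => ξ j ^ 2) (fun j _ => sq_nonneg _) (Finset.mem_univ i)

theorem quot_int (m : ℕ) (q : En (2*m+2) → ℝ) (hqm : Measurable q) (c : ℝ) (hc : 0 < c)
    (hqc : ∀ ξ, c * ‖ξ‖ ^ (2*m) ≤ q ξ) (f : En (2*m+2) → ℝ) (hf : Measurable f) (h : 𝓢(En (2*m+2), ℂ))
    (hfh : ∀ ξ, |f ξ| ≤ ‖h ξ‖) : Integrable (fun ξ => f ξ / q ξ) := by
  have hae : ∀ᵐ ξ : En (2*m+2), ξ ≠ 0 := by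
    have : volume ({0} : Set (En (2*m+2))) = 0 := measure_singleton _
    exact measure_eq_zero_iff_ae_notMem.1 this
  refine ((div_int m h).const_mul c⁻¹).mono' (hf.div hqm).aestronglyMeasurable ?_
  filter_upwards [hae] with ξ hξ
  have hξ' : 0 < ‖ξ‖ := norm_pos_iff.2 hξ
  have h0 : 0 < c * ‖ξ‖^(2*m) := by positivity
  have hp0 := h0.trans_le (hqc ξ)
  rw [norm_div, Real.norm_eq_abs, Real.norm_of_nonneg hp0.le]
  calc _ ≤ ‖h ξ‖ / (c * ‖ξ‖^(2*m)) := by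
        gcongr
        · exact hfh ξ
        · exact hqc ξ
    _ = _ := by field_simp

theorem Qs_eq (n m : ℕ) (hm : 2 ≤ m) (i : Fin n) (α ε : ℝ) (ξ : En n) (hξ : ξ ≠ 0) :
    Qs n m i α ε ξ = ‖ξ‖^(2*m) * ((ξ i ^ 2 / ‖ξ‖^2 - α)^2 + ε) := by
  have hξ' : ‖ξ‖ ≠ 0 := norm_ne_zero_iff.2 hξ
  unfold Qs
  obtain ⟨k, rfl⟩ := Nat.exists_eq_add_of_le hm
  rw [show 2 + k - 2 = k by omega, show 2 * (2 + k) = 2*k + 4 by ring]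
  field_simp
  ring

theorem Qs_meas (n m : ℕ) (i : Fin n) (α ε : ℝ) : Measurable (Qs n m i α ε) :=
  (Qs_temperate n m i α ε).1.continuous.measurable

theorem choose_params (m : ℕ) (hm : 2 ≤ m) : ∃ α ε : ℝ, 0 < ε ∧
    0 < ∫ ξ : En (2*m+2), ((ξ 0 ^ 2 - 0.605 * ‖ξ‖^2) * Real.exp (-Real.pi * ‖ξ‖^2)) / Qs (2*m+2) m 0 α ε ξ := by
  by_contra! hcon
  let D : En (2*m+2) → ℝ := fun ξ => (‖ξ‖^(2*m))⁻¹ * ‖nG _ ξ‖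
  have hD : Integrable D := div_int m (nG _)
  have hD0 : ∀ ξ, 0 ≤ D ξ := fun ξ => by positivity
  let V : Set (En (2*m+2)) := {ξ | 0.7 * ‖ξ‖^2 < ξ 0 ^ 2 ∧ ξ 0 ^ 2 < 0.8 * ‖ξ‖^2}
  have hVo : IsOpen V := by
    have h1 : IsOpen {ξ : En (2*m+2) | 0.7 * ‖ξ‖^2 < ξ 0 ^ 2} := isOpen_lt (by fun_prop) (by fun_prop)
    have h2 : IsOpen {ξ : En (2*m+2) | ξ 0 ^ 2 < 0.8 * ‖ξ‖^2} := isOpen_lt (by fun_prop) (by fun_prop)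
    exact h1.inter h2
  have hVne : V.Nonempty := by
    let x : En (2*m+2) := EuclideanSpace.single 0 (Real.sqrt 3) + EuclideanSpace.single 1 1
    have h10 : (1 : Fin (2*m+2)) ≠ 0 := by
      simp
    have hx0 : x 0 = Real.sqrt 3 := by simp [x]
    have hxn : ‖x‖^2 = 4 := by
      simp only [x]
      rw [norm_add_sq_real]
      simp [EuclideanSpace.inner_single_left]
      norm_num
    refine ⟨x, ?_, ?_⟩ <;> rw [hx0, hxn, Real.sq_sqrt (by norm_num)] <;> norm_num
  have hW : 0 < ∫ ξ, V.indicator D ξ := by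
    refine int_pos _ _ (hD.indicator hVo.measurableSet) (fun x => Set.indicator_nonneg (fun x _ => hD0 x) _) V hVo hVne
      fun ξ hξ => ?_
    rw [Set.indicator_of_mem hξ]
    have : ξ ≠ 0 := by
      rintro rfl
      have := hξ.1
      simp at this
    have h1 : 0 < ‖ξ‖ := norm_pos_iff.2 this
    simp only [D, nG_norm]
    positivity
  set W := ∫ ξ, V.indicator D ξ with hWd
  set D0 := ∫ ξ, D ξ with hD0d
  obtain ⟨N, hN⟩ := exists_nat_gt (max 1 (68 * D0 / (4.75 * W)))
  have hN1 : (1:ℝ) < N := (le_max_left _ _).trans_lt hN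
  have hN2 : 68 * D0 / (4.75 * W) < N := (le_max_right _ _).trans_lt hN
  rw [div_lt_iff₀ (by positivity)] at hN2
  have hN0 : 0 < N := by
    have : (0:ℝ) < N := by linarith
    exact_mod_cast this
  have hδ : 0 < (0.1 / (N:ℝ))^2 := by positivity
  let f : ℕ → En (2*m+2) → ℝ := fun j ξ =>
    ((ξ 0 ^ 2 - 0.605 * ‖ξ‖^2) * Real.exp (-Real.pi * ‖ξ‖^2)) / Qs (2*m+2) m 0 (0.7 + j * (0.1/N)) ((0.1/N)^2) ξ
  have hfi : ∀ j, Integrable (f j) := fun j => by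
    refine quot_int m _ (Qs_meas _ _ _ _ _) _ hδ (Qs_lower _ _ _ _ _) _ (by fun_prop) (nG _) fun ξ => ?_
    rw [nG_norm, abs_mul, abs_of_pos (Real.exp_pos _)]
    gcongr
    have := coord_sq_le _ 0 ξ
    rw [abs_le]
    constructor <;> nlinarith [sq_nonneg (ξ 0), sq_nonneg ‖ξ‖]
  have h1 : ∑ j ∈ Finset.range N, ∫ ξ, f j ξ ≤ 0 := Finset.sum_nonpos fun j _ => hcon _ _ hδ
  rw [← integral_finsetSum _ (fun j _ => hfi j)] at h1
  have h2 : ∫ ξ, ((4.75 * (N:ℝ)^2) * V.indicator D ξ - (68 * N) * D ξ) ≤ ∫ ξ, ∑ j ∈ Finset.range N, f j ξ := by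
    refine integral_mono (((hD.indicator hVo.measurableSet).const_mul _).sub (hD.const_mul _))
      (integrable_finsetSum _ fun j _ => hfi j) fun ξ => ?_
    beta_reduce
    by_cases hξ : ξ = 0
    · subst hξ
      have : (0 : En (2*m+2)) ∉ V := by
        intro h
        have := h.1
        simp at this
      simp [Set.indicator_of_notMem this, D, f, nG_norm]
    · have hξ' : 0 < ‖ξ‖ := norm_pos_iff.2 hξ
      have hps := pointwise_sum N hN0 (ξ 0 ^ 2 / ‖ξ‖^2) (by positivity)
        ((div_le_one (by positivity)).2 (coord_sq_le _ 0 ξ))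
      have e1 : ∑ j ∈ Finset.range N, f j ξ = (∑ j ∈ Finset.range N, (ξ 0 ^ 2 / ‖ξ‖^2 - 0.605) / ((ξ 0 ^ 2 / ‖ξ‖^2 - (0.7 + j * (0.1/N)))^2 + (0.1/N)^2)) * D ξ := by
        rw [Finset.sum_mul]
        refine Finset.sum_congr rfl fun j _ => ?_
        simp only [f]
        rw [Qs_eq _ _ hm _ _ _ _ hξ]
        simp only [D, nG_norm]
        have : 0 < (ξ 0 ^ 2 / ‖ξ‖^2 - (0.7 + j * (0.1/N)))^2 + (0.1/(N:ℝ))^2 := by positivity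
        generalize (ξ 0 ^ 2 / ‖ξ‖^2 - (0.7 + j * (0.1/N)))^2 + (0.1/(N:ℝ))^2 = z at this
        field_simp
      have e2 : (4.75 * (N:ℝ)^2) * V.indicator D ξ = (if 0.7 < (ξ 0 ^ 2 / ‖ξ‖^2) ∧ (ξ 0 ^ 2 / ‖ξ‖^2) < 0.8 then 4.75 * (N:ℝ)^2 else 0) * D ξ := by
        have : ξ ∈ V ↔ 0.7 < (ξ 0 ^ 2 / ‖ξ‖^2) ∧ (ξ 0 ^ 2 / ‖ξ‖^2) < 0.8 := by
          rw [lt_div_iff₀ (by positivity), div_lt_iff₀ (by positivity)]; rfl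
        by_cases hv : ξ ∈ V
        · rw [Set.indicator_of_mem hv, if_pos (this.1 hv)]
        · rw [Set.indicator_of_notMem hv, if_neg (fun h => hv (this.2 h))]; simp
      rw [e1, e2, ← sub_mul]
      exact mul_le_mul_of_nonneg_right hps (hD0 ξ)
  rw [integral_sub ((hD.indicator hVo.measurableSet).const_mul _) (hD.const_mul _), integral_const_mul,
    integral_const_mul, ← hWd, ← hD0d] at h2
  nlinarith

theorem Q_pos (m : ℕ) (α ε : ℝ) (hε : 0 < ε) (ξ : En (2*m+2)) (hξ : ξ ≠ 0) :
    0 < Qs (2*m+2) m 0 α ε ξ := by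
  have : 0 < ‖ξ‖ := norm_pos_iff.2 hξ
  exact (by positivity : 0 < ε * ‖ξ‖^(2*m)).trans_le (Qs_lower _ _ _ _ _ ξ)

theorem Q_nonneg (m : ℕ) (α ε : ℝ) (hε : 0 < ε) (ξ : En (2*m+2)) :
    0 ≤ Qs (2*m+2) m 0 α ε ξ :=
  (by positivity : 0 ≤ ε * ‖ξ‖^(2*m)).trans (Qs_lower _ _ _ _ _ ξ)

theorem int0 (m : ℕ) (α ε : ℝ) (hε : 0 < ε) :
    Integrable (fun ξ : En (2*m+2) => Real.exp (-Real.pi * ‖ξ‖^2) / Qs (2*m+2) m 0 α ε ξ) := by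
  refine quot_int m _ (Qs_meas _ _ _ _ _) _ hε (Qs_lower _ _ _ _ _) _ (by fun_prop) (gaussC _) fun ξ => ?_
  rw [gaussC_norm, abs_of_pos (Real.exp_pos _)]

theorem intN (m : ℕ) (α ε : ℝ) (hε : 0 < ε) :
    Integrable (fun ξ : En (2*m+2) => (‖ξ‖^2 * Real.exp (-Real.pi * ‖ξ‖^2)) / Qs (2*m+2) m 0 α ε ξ) := by
  refine quot_int m _ (Qs_meas _ _ _ _ _) _ hε (Qs_lower _ _ _ _ _) _ (by fun_prop) (nG _) fun ξ => ?_
  rw [nG_norm, abs_of_nonneg (by positivity)]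

theorem intX (m : ℕ) (α ε : ℝ) (hε : 0 < ε) :
    Integrable (fun ξ : En (2*m+2) => (ξ 0 ^ 2 * Real.exp (-Real.pi * ‖ξ‖^2)) / Qs (2*m+2) m 0 α ε ξ) := by
  refine quot_int m _ (Qs_meas _ _ _ _ _) _ hε (Qs_lower _ _ _ _ _) _ (by fun_prop) (nG _) fun ξ => ?_
  rw [nG_norm, abs_of_nonneg (by positivity)]
  exact mul_le_mul_of_nonneg_right (coord_sq_le _ 0 ξ) (Real.exp_pos _).le

theorem scal (m : ℕ) (hm : 2 ≤ m) (α ε : ℝ) (hε : 0 < ε) :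
    (∫ ξ : En (2*m+2), Real.exp (-Real.pi * ‖ξ‖^2) / Qs (2*m+2) m 0 α ε ξ) ≤
      1.21 * (Real.pi * ∫ ξ : En (2*m+2), (‖ξ‖^2 * Real.exp (-Real.pi * ‖ξ‖^2)) / Qs (2*m+2) m 0 α ε ξ) := by
  set f : En (2*m+2) → ℝ := fun ξ => Real.exp (-Real.pi * ‖ξ‖^2) / Qs (2*m+2) m 0 α ε ξ with hf
  have hi0 : Integrable f := int0 m α ε hε
  have hiN := intN m α ε hε
  have h1 := Measure.integral_comp_smul (volume : Measure (En (2*m+2))) f (1.1 : ℝ)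
  have hiR : Integrable (fun ξ => f ((1.1:ℝ) • ξ)) := hi0.comp_smul (by norm_num)
  have h2 : ∫ ξ, (f ξ - (0.21 * Real.pi) * ((‖ξ‖^2 * Real.exp (-Real.pi * ‖ξ‖^2)) / Qs (2*m+2) m 0 α ε ξ)) ≤
      ∫ ξ, (1.1:ℝ)^(2*m) * f ((1.1:ℝ) • ξ) := by
    refine integral_mono (hi0.sub (hiN.const_mul _)) (hiR.const_mul _) fun ξ => ?_
    beta_reduce
    simp only [hf]
    rw [Qs_smul _ _ hm _ _ _ _ _ (by norm_num), norm_smul, mul_div_assoc', mul_div_assoc',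
      mul_div_mul_left _ _ (by positivity : (1.1:ℝ)^(2*m) ≠ 0), ← sub_div]
    refine div_le_div_of_nonneg_right ?_ (Q_nonneg m α ε hε ξ)
    rw [show -Real.pi * (‖(1.1:ℝ)‖ * ‖ξ‖)^2 = (-(0.21 * Real.pi * ‖ξ‖^2)) + -Real.pi * ‖ξ‖^2 by
      rw [Real.norm_of_nonneg (by norm_num)]; ring, Real.exp_add]
    have h3 := mul_le_mul_of_nonneg_right (Real.add_one_le_exp (-(0.21 * Real.pi * ‖ξ‖^2)))
      (Real.exp_pos (-Real.pi * ‖ξ‖^2)).le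
    refine le_trans (le_of_eq ?_) h3
    ring
  rw [integral_const_mul, h1, integral_sub hi0 (hiN.const_mul _), integral_const_mul, finrank_euclideanSpace,
    Fintype.card_fin, abs_of_pos (by positivity), smul_eq_mul, ← mul_assoc,
    show (1.1:ℝ)^(2*m) * ((1.1:ℝ)^(2*m+2))⁻¹ = 1/1.21 by rw [pow_add]; field_simp; norm_num] at h2
  linarith

theorem neg_int (m : ℕ) (hm : 2 ≤ m) (α ε : ℝ) (hε : 0 < ε)
    (h : 0 < ∫ ξ : En (2*m+2), ((ξ 0 ^ 2 - 0.605 * ‖ξ‖^2) * Real.exp (-Real.pi * ‖ξ‖^2)) / Qs (2*m+2) m 0 α ε ξ) :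
    ∫ ξ : En (2*m+2), ((1/(2*Real.pi) - ξ 0 ^ 2) * Real.exp (-Real.pi * ‖ξ‖^2)) / Qs (2*m+2) m 0 α ε ξ < 0 := by
  have hs := scal m hm α ε hε
  have h0 := int0 m α ε hε
  have hX := intX m α ε hε
  have hN := intN m α ε hε
  have e1 : ∫ ξ : En (2*m+2), ((ξ 0 ^ 2 - 0.605 * ‖ξ‖^2) * Real.exp (-Real.pi * ‖ξ‖^2)) / Qs (2*m+2) m 0 α ε ξ
     = (∫ ξ : En (2*m+2), (ξ 0 ^ 2 * Real.exp (-Real.pi * ‖ξ‖^2)) / Qs (2*m+2) m 0 α ε ξ) -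
       0.605 * ∫ ξ : En (2*m+2), (‖ξ‖^2 * Real.exp (-Real.pi * ‖ξ‖^2)) / Qs (2*m+2) m 0 α ε ξ := by
    rw [← integral_const_mul, ← integral_sub hX (hN.const_mul _)]
    congr 1; ext ξ; ring
  have e2 : ∫ ξ : En (2*m+2), ((1/(2*Real.pi) - ξ 0 ^ 2) * Real.exp (-Real.pi * ‖ξ‖^2)) / Qs (2*m+2) m 0 α ε ξ
     = 1/(2*Real.pi) * (∫ ξ : En (2*m+2), Real.exp (-Real.pi * ‖ξ‖^2) / Qs (2*m+2) m 0 α ε ξ) -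
       ∫ ξ : En (2*m+2), (ξ 0 ^ 2 * Real.exp (-Real.pi * ‖ξ‖^2)) / Qs (2*m+2) m 0 α ε ξ := by
    rw [← integral_const_mul, ← integral_sub (h0.const_mul _) hX]
    congr 1; ext ξ; ring
  rw [e2]
  rw [e1] at h
  have hpi := Real.pi_pos
  have h3 := mul_le_mul_of_nonneg_left hs (by positivity : 0 ≤ 1/(2*Real.pi))
  rw [show ∀ Z : ℝ, 1/(2*Real.pi) * (1.21 * (Real.pi * Z)) = 0.605 * Z by intro Z; field_simp; ring] at h3
  linarith

theorem real_form (m : ℕ) (q : En (2*m+2) → ℝ) (F : 𝓢(En (2*m+2), ℂ)) (g : En (2*m+2) → ℝ)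
    (hF : ∀ ξ, (𝓕 F : 𝓢(En (2*m+2), ℂ)) ξ = ((g ξ : ℝ) : ℂ)) :
    (∫ ξ, (𝓕 F : 𝓢(En (2*m+2), ℂ)) ξ / (((2 * Real.pi)^(2*m) * q ξ : ℝ) : ℂ)).re =
      ((2 * Real.pi)^(2*m))⁻¹ * ∫ ξ, g ξ / q ξ := by
  have : ∀ ξ, (𝓕 F : 𝓢(En (2*m+2), ℂ)) ξ / (((2 * Real.pi)^(2*m) * q ξ : ℝ) : ℂ) =
      ((((2 * Real.pi)^(2*m))⁻¹ * (g ξ / q ξ) : ℝ) : ℂ) := fun ξ => by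
    rw [hF, ← Complex.ofReal_div]
    congr 1
    rw [div_mul_eq_div_div, div_eq_mul_inv (g ξ), div_eq_mul_inv, div_eq_mul_inv]; ring
  simp only [this]
  rw [integral_complex_ofReal, Complex.ofReal_re, integral_const_mul]

end Helpers

/-- For every m ≥ 2 and n = 2m+2 there is a uniformly elliptic
constant-coefficient operator of order 2m whose (2m−n)-homogeneous fundamental
solutions all change sign. -/
theorem stmt18 (m : ℕ) (hm : 2 ≤ m) :
    ∃ A : (Fin (2*m) → Fin (2*m+2)) → ℝ, ∃ lam : ℝ, 0 < lam ∧
      (∀ ξ : En (2*m+2), lam * ‖ξ‖^(2*m) ≤ symbolQ (2*m+2) m A ξ) ∧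
      ∀ K : En (2*m+2) → ℝ,
        LocallyIntegrable K volume →
        ContinuousOn K {(0 : En (2*m+2))}ᶜ →
        HomogeneousDeg (2*m+2) ((2*m : ℝ) - (2*m+2 : ℕ)) K →
        IsFundamentalSolution (2*m+2) m A K →
        (∃ y : En (2*m+2), y ≠ 0 ∧ 0 < K y) ∧
        (∃ z : En (2*m+2), z ≠ 0 ∧ K z < 0) := by
  obtain ⟨α, ε, hε, hpos⟩ := choose_params m hm
  obtain ⟨A, hA⟩ := Qs_rep (2*m+2) m hm 0 α ε
  have hneg := neg_int m hm α ε hε hpos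
  refine ⟨A, ε, hε, fun ξ => (Qs_lower _ _ _ _ _ ξ).trans_eq (hA ξ).symm, fun K hK hc hh hfund => ?_⟩
  obtain ⟨C, hC0, hC⟩ := K_bound _ _ K (by push_cast; ring) hc hh
  have hae : ∀ᵐ ξ : En (2*m+2), ξ ≠ 0 := by
    have : volume ({0} : Set (En (2*m+2))) = 0 := measure_singleton _
    exact measure_eq_zero_iff_ae_notMem.1 this
  have key := main_ext m A K _ hA (Qs_temperate _ _ _ _ _) ε hε (Qs_lower _ _ _ _ _) C hC0 hC hK hfund
  have hcp : 0 < ((2 * Real.pi)^(2*m))⁻¹ := by positivity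
  constructor
  · by_contra! hcon
    have h1 := key (gaussC _)
    rw [real_form m _ (gaussC _) (fun ξ => Real.exp (-Real.pi * ‖ξ‖^2))
      (fun ξ => by rw [gaussC_fourier, gaussC_apply])] at h1
    have h2 : ∫ x, K x * (gaussC _ x).re ≤ 0 := by
      apply integral_nonpos_of_ae
      filter_upwards [hae] with x hx
      rw [gaussC_apply, Complex.ofReal_re]
      exact mul_nonpos_of_nonpos_of_nonneg (hcon x hx) (Real.exp_pos _).le
    have h3 : 0 < ∫ ξ : En (2*m+2), Real.exp (-Real.pi * ‖ξ‖^2) / Qs (2*m+2) m 0 α ε ξ := by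
      refine int_pos _ _ (int0 m α ε hε) (fun x => div_nonneg (Real.exp_pos _).le (Q_nonneg m α ε hε x)) {0}ᶜ
        isOpen_compl_singleton ⟨stdB _ 0, ?_⟩ fun x hx => div_pos (Real.exp_pos _) (Q_pos m α ε hε x hx)
      intro h
      have := norm_stdB (2*m+2) 0
      rw [Set.mem_singleton_iff.1 h] at this
      simp at this
    have := mul_pos hcp h3
    linarith
  · by_contra! hcon
    have h1 := key (ttG _ (stdB _ 0))
    have hin : ∀ ξ : En (2*m+2), inner ℝ ξ (stdB _ 0) = ξ 0 := fun ξ => by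
      simp [stdB, EuclideanSpace.inner_single_right]
    rw [real_form m _ (ttG _ (stdB _ 0)) (fun ξ => (1/(2*Real.pi) - ξ 0 ^ 2) * Real.exp (-Real.pi * ‖ξ‖^2))
      (fun ξ => by rw [fourier_ttG _ _ (norm_stdB _ _), hin])] at h1
    have h2 : 0 ≤ ∫ x, K x * (ttG _ (stdB _ 0) x).re := by
      apply integral_nonneg_of_ae
      filter_upwards [hae] with x hx
      rw [ttG_apply, Complex.ofReal_re]
      exact mul_nonneg (hcon x hx) (by positivity)
    have := mul_neg_of_pos_of_neg hcp hneg
    linarith
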